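/- Let G be a finite connected distance-hereditary graph. (i) If diam(G) < 2·rad(G), then every vertex v satisfies e(v) = d(v, C(G)) + rad(G). (ii) Every vertex v ∉ C(G) satisfies e(v) = d(v, C¹(G)) + rad(G) + 1. -/

import Mathlib

/-- A graph is distance-hereditary if every connected induced subgraph is isometric
(equivalently, every induced path is a shortest path). -/
def DistHereditary {V : Type*} (G : SimpleGraph V) : Prop :=
  ∀ s : Set V, (G.induce s).Connected →
    ∀ u v : s, (G.induce s).dist u v = G.dist (u : V) (v : V)

/-- Eccentricity of a vertex: `e(v) = max_{u} d(v,u)`. -/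
noncomputable def ecc {V : Type*} [Fintype V] (G : SimpleGraph V) (v : V) : ℕ :=
  Finset.univ.sup (fun u => G.dist v u)

/-- Radius: minimum eccentricity. -/
noncomputable def rad {V : Type*} [Fintype V] (G : SimpleGraph V) : ℕ :=
  sInf (Set.range (ecc G))

/-- Diameter: maximum eccentricity. -/
noncomputable def diam {V : Type*} [Fintype V] (G : SimpleGraph V) : ℕ :=
  Finset.univ.sup (fun v => ecc G v)

/-- The center: vertices of minimum eccentricity. -/
def center {V : Type*} [Fintype V] (G : SimpleGraph V) : Set V :=
  {v | ecc G v = rad G}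

/-- Distance from a vertex to a set of vertices: `d(v,S) = min_{s ∈ S} d(v,s)`. -/
noncomputable def distToSet {V : Type*} (G : SimpleGraph V) (v : V) (S : Set V) : ℕ :=
  sInf ((G.dist v) '' S)

/-- The interval `I(x,y)`: vertices on shortest `(x,y)`-paths. -/
def interval {V : Type*} (G : SimpleGraph V) (x y : V) : Set V :=
  {v | G.dist x v + G.dist v y = G.dist x y}

/-- The intervalSlice `S_k(x,y) = {v ∈ I(x,y) : d(x,v) = k}`. -/
def intervalSlice {V : Type*} (G : SimpleGraph V) (x y : V) (k : ℕ) : Set V :=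
  {v | v ∈ interval G x y ∧ G.dist x v = k}

/-- The set `S` induces a cograph in `G`: no induced path on four vertices within `S`. -/
def IsCographOn {V : Type*} (G : SimpleGraph V) (S : Set V) : Prop :=
  ¬ ∃ a b c d : V, a ∈ S ∧ b ∈ S ∧ c ∈ S ∧ d ∈ S ∧
    a ≠ c ∧ a ≠ d ∧ b ≠ d ∧
    G.Adj a b ∧ G.Adj b c ∧ G.Adj c d ∧ ¬ G.Adj a c ∧ ¬ G.Adj a d ∧ ¬ G.Adj b d

section DistanceHereditary

variable {V : Type*} {G : SimpleGraph V}

/-- In a distance-hereditary graph the support of every walk contains a geodesic. -/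
theorem DistHereditary.exists_geodesic_in_support (hdh : DistHereditary G) {x y : V}
    (W : G.Walk x y) :
    ∃ Q : G.Walk x y, (∀ z ∈ Q.support, z ∈ W.support) ∧ Q.length = G.dist x y := by
  have hs := W.connected_induce_support
  obtain ⟨P, hP⟩ := hs.exists_walk_length_eq_dist ⟨x, W.start_mem_support⟩ ⟨y, W.end_mem_support⟩
  let f := (SimpleGraph.Embedding.induce (G := G) {z | z ∈ W.support}).toHom
  refine ⟨P.map f, fun z hz => ?_, ?_⟩
  · obtain ⟨a, -, rfl⟩ := List.mem_map.1 (SimpleGraph.Walk.support_map f P ▸ hz)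
    exact a.2
  · exact (SimpleGraph.Walk.length_map f P).trans (hP.trans (hdh _ hs _ _))

/-- Every walk leaving `v` towards `y` meets a neighbour of `v` that is closer to `y`. -/
theorem DistHereditary.exists_adj_closer (hdh : DistHereditary G) (hconn : G.Connected) {v y : V}
    (hne : v ≠ y) (W : G.Walk v y) :
    ∃ t ∈ W.support, G.Adj v t ∧ G.dist t y + 1 = G.dist v y := by
  obtain ⟨Q, hQ, hlen⟩ := hdh.exists_geodesic_in_support W
  cases Q with
  | nil => exact absurd rfl hne
  | @cons _ t _ h Q =>
    refine ⟨t, hQ t (by simp), h, ?_⟩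
    have h1 := SimpleGraph.dist_le Q
    have h2 := hconn.dist_triangle (u := v) (v := t) (w := y)
    rw [SimpleGraph.dist_eq_one_iff_adj.2 h] at h2
    rw [SimpleGraph.Walk.length_cons] at hlen
    omega

theorem dist_add_dist_le_length {x y z : V} (W : G.Walk x y) (hz : z ∈ W.support) :
    G.dist x z + G.dist z y ≤ W.length := by
  classical
  have h := congrArg SimpleGraph.Walk.length (W.take_spec hz)
  rw [SimpleGraph.Walk.length_append] at h
  have h1 := SimpleGraph.dist_le (W.takeUntil z hz)
  have h2 := SimpleGraph.dist_le (W.dropUntil z hz)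
  omega

theorem exists_walk_in_interval (hconn : G.Connected) (x y : V) :
    ∃ P : G.Walk x y, ∀ z ∈ P.support, z ∈ interval G x y := by
  obtain ⟨P, hP⟩ := hconn.exists_walk_length_eq_dist x y
  refine ⟨P, fun z hz => ?_⟩
  have h1 := dist_add_dist_le_length P hz
  have h2 := hconn.dist_triangle (u := x) (v := z) (w := y)
  simp only [interval, Set.mem_ofPred_eq]
  omega

/-- If `w` precedes `x` on a geodesic from its neighbour `v`, then a geodesic from `w` to `x`
leaves the closed neighbourhood of `v` right after `w`. -/
theorem two_le_dist_of_mem_interval (hconn : G.Connected) {v w x z : V}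
    (hw : G.dist w x + 1 = G.dist v x) (hz : z ∈ interval G w x) (hne : z ≠ w) :
    2 ≤ G.dist v z := by
  simp only [interval, Set.mem_ofPred_eq] at hz
  have h1 := hconn.dist_triangle (u := v) (v := z) (w := x)
  have h2 := hconn.pos_dist_of_ne hne.symm
  omega

/-- Vertices joined by a walk outside the closed neighbourhood of `v` are reached from `v`
through the same neighbours. -/
theorem DistHereditary.closer_of_walk (hdh : DistHereditary G) (hconn : G.Connected)
    {v w x y : V} (P : G.Walk x y) (hP : ∀ z ∈ P.support, 2 ≤ G.dist v z)
    (hvw : G.Adj v w) (hw : G.dist w x + 1 = G.dist v x) :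
    G.dist w y + 1 = G.dist v y := by
  obtain ⟨Q, hQ⟩ := exists_walk_in_interval hconn w x
  have hne : v ≠ y := by
    rintro rfl
    have := hP _ P.end_mem_support
    simp at this
  obtain ⟨t, ht, hvt, hty⟩ := hdh.exists_adj_closer hconn hne (.cons hvw (Q.append P))
  have h1 := SimpleGraph.dist_eq_one_iff_adj.2 hvt
  rw [SimpleGraph.Walk.support_cons, List.mem_cons, SimpleGraph.Walk.mem_support_append_iff] at ht
  rcases ht with rfl | ht | ht
  · exact absurd hvt (G.irrefl)
  · by_cases htw : t = w
    · exact htw ▸ hty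
    · have := two_le_dist_of_mem_interval hconn hw (hQ t ht) htw
      omega
  · have := hP t ht
    omega

/-- If `x` and `y` are not reached from `v` through the same neighbours, then every walk between
them meets a vertex of the closed neighbourhood of `v` lying on a geodesic between them. -/
theorem DistHereditary.exists_mem_interval_near (hdh : DistHereditary G) (hconn : G.Connected)
    {v x y : V} (hS : intervalSlice G v x 1 ≠ intervalSlice G v y 1) (W : G.Walk x y) :
    ∃ z ∈ W.support, G.dist v z ≤ 1 ∧ G.dist x z + G.dist z y ≤ G.dist x y := by
  obtain ⟨Q, hQ, hlen⟩ := hdh.exists_geodesic_in_support W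
  by_contra! hcon
  have hfar : ∀ z ∈ Q.support, 2 ≤ G.dist v z := by
    intro z hz
    by_contra! hlt
    have := hcon z (hQ z hz) (by omega)
    have := dist_add_dist_le_length Q hz
    omega
  apply hS
  ext w
  simp only [intervalSlice, interval, Set.mem_ofPred_eq]
  constructor
  · rintro ⟨h1, h2⟩
    have := hdh.closer_of_walk hconn Q hfar (SimpleGraph.dist_eq_one_iff_adj.1 h2) (by omega)
    exact ⟨by omega, h2⟩
  · rintro ⟨h1, h2⟩
    have := hdh.closer_of_walk hconn Q.reverse
      (fun z hz => hfar z (by simpa using hz)) (SimpleGraph.dist_eq_one_iff_adj.1 h2) (by omega)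
    exact ⟨by omega, h2⟩

/-- A metric form of the laminarity of the first slices `S_1(v, x)`. -/
theorem DistHereditary.dist_lower_bound (hdh : DistHereditary G) (hconn : G.Connected)
    {v x y u t : V} (hS : intervalSlice G v x 1 ≠ intervalSlice G v y 1)
    (hu : u ∈ intervalSlice G v x 1) (ht : t ∈ intervalSlice G v y 1) :
    G.dist v x + G.dist v y ≤ G.dist x y ∨ G.dist u x + G.dist u y ≤ G.dist x y ∨
      G.dist t x + G.dist t y ≤ G.dist x y := by
  simp only [intervalSlice, interval, Set.mem_ofPred_eq] at hu ht
  obtain ⟨P, hP⟩ := exists_walk_in_interval hconn u x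
  obtain ⟨Q, hQ⟩ := exists_walk_in_interval hconn t y
  have hvu := SimpleGraph.dist_eq_one_iff_adj.1 hu.2
  have hvt := SimpleGraph.dist_eq_one_iff_adj.1 ht.2
  obtain ⟨z, hz, hz1, hzd⟩ := hdh.exists_mem_interval_near hconn hS
    (P.reverse.append (.cons hvu.symm (.cons hvt Q)))
  rw [SimpleGraph.dist_comm (u := x) (v := z)] at hzd
  simp only [SimpleGraph.Walk.mem_support_append_iff, SimpleGraph.Walk.support_reverse,
    List.mem_reverse, SimpleGraph.Walk.support_cons, List.mem_cons] at hz
  rcases hz with hz | rfl | rfl | hz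
  · by_cases h : z = u
    · exact .inr (.inl (h ▸ hzd))
    · have := two_le_dist_of_mem_interval (v := v) hconn (by omega) (hP z hz) h
      omega
  · exact .inr (.inl hzd)
  · exact .inl hzd
  · by_cases h : z = t
    · exact .inr (.inr (h ▸ hzd))
    · have := two_le_dist_of_mem_interval (v := v) hconn (by omega) (hQ z hz) h
      omega

/-- A neighbour `t` of `v` that is no farther from `x` than `v` is closer to `x`, or adjacent to
every neighbour of `v` that is closer to `x`. -/
theorem DistHereditary.closer_or_adj (hdh : DistHereditary G) (hconn : G.Connected)
    {v x w t : V} (hx : 2 ≤ G.dist v x) (hw : w ∈ intervalSlice G v x 1) (hvt : G.Adj v t)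
    (htx : G.dist t x ≤ G.dist v x) :
    t ∈ intervalSlice G v x 1 ∨ G.Adj t w := by
  simp only [intervalSlice, interval, Set.mem_ofPred_eq] at hw ⊢
  have hvt1 := SimpleGraph.dist_eq_one_iff_adj.2 hvt
  obtain ⟨P, hP⟩ := exists_walk_in_interval hconn w x
  have hne : t ≠ x := by
    rintro rfl
    omega
  obtain ⟨z, hz, htz, hzx⟩ := hdh.exists_adj_closer hconn hne
    (.cons hvt.symm (.cons (SimpleGraph.dist_eq_one_iff_adj.1 hw.2) P))
  simp only [SimpleGraph.Walk.support_cons, List.mem_cons] at hz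
  rcases hz with rfl | rfl | hz
  · exact absurd htz G.irrefl
  · omega
  · by_cases h : z = w
    · exact .inr (h ▸ htz)
    · left
      have h1 := hconn.pos_dist_of_ne (Ne.symm h)
      have h2 := hP z hz
      simp only [interval, Set.mem_ofPred_eq] at h2
      have h3 := hconn.dist_triangle (u := v) (v := t) (w := x)
      exact ⟨by omega, hvt1⟩

theorem intervalSlice_one_nonempty (hconn : G.Connected) {v x : V} (hne : v ≠ x) :
    (intervalSlice G v x 1).Nonempty := by
  obtain ⟨P, hP⟩ := hconn.exists_walk_length_eq_dist v x
  cases P with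
  | nil => exact absurd rfl hne
  | @cons _ w _ h P =>
    have h1 := SimpleGraph.dist_le P
    have h2 := hconn.dist_triangle (u := v) (v := w) (w := x)
    have h3 := SimpleGraph.dist_eq_one_iff_adj.2 h
    rw [SimpleGraph.Walk.length_cons] at hP
    refine ⟨w, ?_, h3⟩
    simp only [interval, Set.mem_ofPred_eq]
    omega

variable [Fintype V]

theorem dist_le_ecc (v x : V) : G.dist v x ≤ ecc G v :=
  Finset.le_sup (f := fun u => G.dist v u) (Finset.mem_univ x)

theorem exists_dist_eq_ecc (v : V) : ∃ x, G.dist v x = ecc G v := by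
  obtain ⟨x, -, hx⟩ := Finset.exists_mem_eq_sup Finset.univ ⟨v, Finset.mem_univ v⟩
    (fun u => G.dist v u)
  exact ⟨x, hx.symm⟩

theorem rad_le_ecc (v : V) : rad G ≤ ecc G v := Nat.sInf_le ⟨v, rfl⟩

theorem ecc_le_diam (v : V) : ecc G v ≤ diam G :=
  Finset.le_sup (f := fun u => ecc G u) (Finset.mem_univ v)

theorem exists_ecc_eq_rad [Nonempty V] : ∃ c, ecc G c = rad G :=
  Nat.sInf_mem (Set.range_nonempty (ecc G))

theorem ecc_le_dist_add_ecc (hconn : G.Connected) (v s : V) :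
    ecc G v ≤ G.dist v s + ecc G s := by
  obtain ⟨x, hx⟩ := exists_dist_eq_ecc (G := G) v
  have h1 := hconn.dist_triangle (u := v) (v := s) (w := x)
  have h2 := dist_le_ecc (G := G) s x
  omega

theorem dist_le_two_mul_rad (hconn : G.Connected) (x y : V) : G.dist x y ≤ 2 * rad G := by
  have := hconn.nonempty
  obtain ⟨c, hc⟩ := exists_ecc_eq_rad (G := G)
  have h1 := hconn.dist_triangle (u := x) (v := c) (w := y)
  have h2 := dist_le_ecc (G := G) c x
  have h3 := dist_le_ecc (G := G) c y
  rw [SimpleGraph.dist_comm] at h2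
  omega

/-- A vertex `v` whose doubled eccentricity exceeds the diameter by at least three has a
neighbour of smaller eccentricity. -/
theorem DistHereditary.exists_adj_ecc_lt (hdh : DistHereditary G) (hconn : G.Connected) {v : V}
    (hdiam : ∀ x y, G.dist x y + 3 ≤ 2 * ecc G v) :
    ∃ w, G.Adj v w ∧ ecc G w < ecc G v := by
  obtain ⟨y, hy⟩ := exists_dist_eq_ecc (G := G) v
  have hk := hdiam v y
  obtain ⟨x₀, hx₀, hmin⟩ := Set.exists_min_image {x | ecc G v ≤ G.dist v x + 1}
    (fun x => (intervalSlice G v x 1).ncard) (Set.toFinite _) ⟨y, by simp [hy]⟩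
  simp only [Set.mem_ofPred_eq] at hx₀ hmin
  have hne : v ≠ x₀ := by
    rintro rfl
    simp at hx₀
    omega
  obtain ⟨w, hw⟩ := intervalSlice_one_nonempty hconn hne
  have hvw := SimpleGraph.dist_eq_one_iff_adj.1 hw.2
  have hwx₀ := hw.1
  simp only [interval, Set.mem_ofPred_eq, hw.2] at hwx₀
  refine ⟨w, hvw, ?_⟩
  obtain ⟨x, hx⟩ := exists_dist_eq_ecc (G := G) w
  rw [← hx]
  by_contra! hcon
  have htri := hconn.dist_triangle (u := w) (v := v) (w := x)
  rw [SimpleGraph.dist_comm (u := w) (v := v), hw.2] at htri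
  have hxk := dist_le_ecc (G := G) v x
  have hx₀k := dist_le_ecc (G := G) v x₀
  have hd := hdiam x₀ x
  have hS : intervalSlice G v x₀ 1 ≠ intervalSlice G v x 1 := by
    intro h
    have h1 := (h ▸ hw).1
    have h2 := hw.2
    simp only [interval, Set.mem_ofPred_eq] at h1
    omega
  have hsub : intervalSlice G v x 1 ⊆ intervalSlice G v x₀ 1 := by
    intro t ht
    have htx := ht.1
    simp only [interval, Set.mem_ofPred_eq, ht.2] at htx
    have hlow := hdh.dist_lower_bound hconn hS hw ht
    rcases hdh.closer_or_adj hconn (by omega) hw (SimpleGraph.dist_eq_one_iff_adj.1 ht.2)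
      (by omega) with h | h
    · exact h
    · have h1 := hconn.dist_triangle (u := w) (v := t) (w := x)
      rw [SimpleGraph.dist_eq_one_iff_adj.2 h.symm] at h1
      have h2 := hconn.dist_triangle (u := v) (v := t) (w := x₀)
      have h3 := ht.2
      exact ⟨by simp only [interval, Set.mem_ofPred_eq]; omega, h3⟩
  exact hS (Set.eq_of_subset_of_ncard_le hsub (hmin x (by omega)) (Set.toFinite _)).symm

/-- If every vertex of eccentricity above `m` has a neighbour of smaller eccentricity, then the
eccentricity is determined above level `m` by the distance to the sublevel set. -/
theorem ecc_eq_distToSet_add (hconn : G.Connected) {m : ℕ}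
    (hdesc : ∀ v, m < ecc G v → ∃ w, G.Adj v w ∧ ecc G w < ecc G v) {v : V} (hv : m ≤ ecc G v) :
    ecc G v = distToSet G v {w | ecc G w ≤ m} + m := by
  have key : ∀ n v, ecc G v = m + n → ∃ s, ecc G s ≤ m ∧ G.dist v s ≤ n := by
    intro n
    induction n with
    | zero => exact fun v hv => ⟨v, by omega, by simp⟩
    | succ n ih =>
      intro v hv
      obtain ⟨w, hvw, hw⟩ := hdesc v (by omega)
      have h1 := SimpleGraph.dist_eq_one_iff_adj.2 hvw
      have h2 := ecc_le_dist_add_ecc hconn v w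
      obtain ⟨s, hs, hd⟩ := ih w (by omega)
      have h3 := hconn.dist_triangle (u := v) (v := w) (w := s)
      exact ⟨s, hs, by omega⟩
  obtain ⟨s, hs, hd⟩ := key (ecc G v - m) v (by omega)
  have hle : distToSet G v {w | ecc G w ≤ m} ≤ G.dist v s := Nat.sInf_le ⟨s, hs, rfl⟩
  obtain ⟨s', hs', hd'⟩ : distToSet G v {w | ecc G w ≤ m} ∈ G.dist v '' {w | ecc G w ≤ m} :=
    Nat.sInf_mem ⟨_, s, hs, rfl⟩
  have h := ecc_le_dist_add_ecc hconn v s'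
  simp only [Set.mem_ofPred_eq] at hs'
  omega

end DistanceHereditary

/-- In a finite connected distance-hereditary graph:
(i) if `diam(G) < 2·rad(G)` then every vertex `v` satisfies `e(v) = d(v, C(G)) + rad(G)`;
(ii) every vertex `v ∉ C(G)` satisfies `e(v) = d(v, C¹(G)) + rad(G) + 1`. -/
theorem ecc_function_eqn {V : Type*} [Fintype V] (G : SimpleGraph V)
    (hconn : G.Connected) (hdh : DistHereditary G) :
    (diam G < 2 * rad G →
      ∀ v : V, ecc G v = distToSet G v (center G) + rad G) ∧
    (∀ v : V, v ∉ center G →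
      ecc G v = distToSet G v {w | ecc G w ≤ rad G + 1} + rad G + 1) := by
  refine ⟨fun hdiam v => ?_, fun v hv => ?_⟩
  · have hcenter : center G = {w | ecc G w ≤ rad G} :=
      Set.ext fun w => ⟨fun h => le_of_eq h, fun h => le_antisymm h (rad_le_ecc w)⟩
    rw [hcenter]
    refine ecc_eq_distToSet_add hconn (fun u hu => ?_) (rad_le_ecc v)
    refine hdh.exists_adj_ecc_lt hconn fun x y => ?_
    have h1 := dist_le_ecc (G := G) x y
    have h2 := ecc_le_diam (G := G) x
    omega
  · have hlt : rad G < ecc G v := lt_of_le_of_ne (rad_le_ecc v) (Ne.symm hv)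
    rw [add_assoc]
    refine ecc_eq_distToSet_add hconn (fun u hu => ?_) hlt
    refine hdh.exists_adj_ecc_lt hconn fun x y => ?_
    have := dist_le_two_mul_rad hconn x y
    omega
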